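/- Under the permutation null distribution, for n ≥ 3 and every integer t with 1 ≤ t ≤ n−1, Cov(R_out,2(t), R_in,1(t)) = −[t(n−t)(n−t−1)/(n(n−1)(n−2))] · ( Σ_{u=1}^n D_uu·D_u − (2/n)|G_in||G_out| ). -/

import Mathlib

open scoped BigOperators Classical

noncomputable section

namespace CPD

/-- Nodes: `n` individuals, each with `ℓ` repeated measurements. -/
abbrev Node (n ℓ : ℕ) := Fin n × Fin ℓ

/-- The (unordered) pair of individuals joined by an edge. -/
def indPair {n ℓ : ℕ} (e : Sym2 (Node n ℓ)) : Sym2 (Fin n) := Sym2.map Prod.fst e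

/-- Between-individual edges of the graph `Gr`. -/
def Gout {n ℓ : ℕ} (Gr : Finset (Sym2 (Node n ℓ))) : Finset (Sym2 (Node n ℓ)) :=
  Gr.filter fun e => ¬ (indPair e).IsDiag

/-- Within-individual edges of the graph `Gr`. -/
def Gin {n ℓ : ℕ} (Gr : Finset (Sym2 (Node n ℓ))) : Finset (Sym2 (Node n ℓ)) :=
  Gr.filter fun e => (indPair e).IsDiag

/-- `D Gr u v`: the number of edges of `Gr` between individual `u` and individual `v`
(for `u = v`, the number of within-individual edges of individual `u`). -/
def D {n ℓ : ℕ} (Gr : Finset (Sym2 (Node n ℓ))) (u v : Fin n) : ℕ :=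
  (Gr.filter fun e => indPair e = s(u, v)).card

/-- `Ddeg Gr u = ∑_{v ≠ u} D Gr u v`. -/
def Ddeg {n ℓ : ℕ} (Gr : Finset (Sym2 (Node n ℓ))) (u : Fin n) : ℕ :=
  ∑ v ∈ Finset.univ.filter fun v => v ≠ u, D Gr u v

/-- Number of between-individual edges both of whose endpoints belong to individuals whose
permuted label (in `{1, …, n}`) is `≤ t`. -/
def Rout1 {n ℓ : ℕ} (Gr : Finset (Sym2 (Node n ℓ))) (t : ℕ) (σ : Equiv.Perm (Fin n)) : ℕ :=
  ((Gout Gr).filter fun e => ∀ x ∈ e, ((σ x.1 : ℕ) + 1 ≤ t)).card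

/-- Number of between-individual edges both of whose endpoints belong to individuals whose
permuted label is `> t`. -/
def Rout2 {n ℓ : ℕ} (Gr : Finset (Sym2 (Node n ℓ))) (t : ℕ) (σ : Equiv.Perm (Fin n)) : ℕ :=
  ((Gout Gr).filter fun e => ∀ x ∈ e, (t ≤ (σ x.1 : ℕ))).card

/-- Number of within-individual edges both of whose endpoints belong to individuals whose
permuted label is `≤ t`. -/
def Rin1 {n ℓ : ℕ} (Gr : Finset (Sym2 (Node n ℓ))) (t : ℕ) (σ : Equiv.Perm (Fin n)) : ℕ :=
  ((Gin Gr).filter fun e => ∀ x ∈ e, ((σ x.1 : ℕ) + 1 ≤ t)).card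

/-- Expectation under the permutation null distribution (uniform over the `n!` permutations of
the individual labels). -/
def pexp {n : ℕ} (f : Equiv.Perm (Fin n) → ℝ) : ℝ :=
  (∑ σ : Equiv.Perm (Fin n), f σ) / (Nat.factorial n)

/-- Covariance under the permutation null distribution. -/
def pcov {n : ℕ} (f g : Equiv.Perm (Fin n) → ℝ) : ℝ :=
  pexp fun σ => (f σ - pexp f) * (g σ - pexp g)

/-- Variance under the permutation null distribution. -/
def pvar {n : ℕ} (f : Equiv.Perm (Fin n) → ℝ) : ℝ := pcov f f

/-- The weighted edge-count statistic
`R_out,w(t) = ((n−t−1)·R_out,1(t) + (t−1)·R_out,2(t))/(n−2)`. -/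
def Routw {n ℓ : ℕ} (Gr : Finset (Sym2 (Node n ℓ))) (t : ℕ) (σ : Equiv.Perm (Fin n)) : ℝ :=
  (((n : ℝ) - t - 1) * (Rout1 Gr t σ : ℝ) + ((t : ℝ) - 1) * (Rout2 Gr t σ : ℝ)) / ((n : ℝ) - 2)

/-- The difference edge-count statistic `R_out,d(t) = R_out,1(t) − R_out,2(t)`. -/
def Routd {n ℓ : ℕ} (Gr : Finset (Sym2 (Node n ℓ))) (t : ℕ) (σ : Equiv.Perm (Fin n)) : ℝ :=
  (Rout1 Gr t σ : ℝ) - (Rout2 Gr t σ : ℝ)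

/-- Standardized weighted between-individual statistic `Z_out,w(t)`. -/
def Zoutw {n ℓ : ℕ} (Gr : Finset (Sym2 (Node n ℓ))) (t : ℕ) (σ : Equiv.Perm (Fin n)) : ℝ :=
  (Routw Gr t σ - pexp (Routw Gr t)) / Real.sqrt (pvar (Routw Gr t))

/-- Standardized difference statistic `Z_out,d(t)`. -/
def Zoutd {n ℓ : ℕ} (Gr : Finset (Sym2 (Node n ℓ))) (t : ℕ) (σ : Equiv.Perm (Fin n)) : ℝ :=
  (Routd Gr t σ - pexp (Routd Gr t)) / Real.sqrt (pvar (Routd Gr t))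

/-- Standardized within-individual statistic `Z_in(t)`. -/
def Zin {n ℓ : ℕ} (Gr : Finset (Sym2 (Node n ℓ))) (t : ℕ) (σ : Equiv.Perm (Fin n)) : ℝ :=
  ((Rin1 Gr t σ : ℝ) - pexp (fun τ => (Rin1 Gr t τ : ℝ))) /
    Real.sqrt (pvar (fun τ => (Rin1 Gr t τ : ℝ)))

/-- The constant
`ϱ = (Σ_u D_uu·D_u − (2/n)|G_in||G_out|) / sqrt((Σ_u D_u² − 4|G_out|²/n)(Σ_u D_uu² − |G_in|²/n))`. -/
def varrho {n ℓ : ℕ} (Gr : Finset (Sym2 (Node n ℓ))) : ℝ :=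
  ((∑ u : Fin n, (D Gr u u : ℝ) * (Ddeg Gr u : ℝ)) -
      2 / (n : ℝ) * ((Gin Gr).card : ℝ) * ((Gout Gr).card : ℝ)) /
    Real.sqrt (((∑ u : Fin n, (Ddeg Gr u : ℝ) ^ 2) - 4 * ((Gout Gr).card : ℝ) ^ 2 / (n : ℝ)) *
      ((∑ u : Fin n, (D Gr u u : ℝ) ^ 2) - ((Gin Gr).card : ℝ) ^ 2 / (n : ℝ)))


/-- The indicator that a permuted label (in `{1, …, n}`) is `≤ t`. -/
def lowInd {n : ℕ} (t : ℕ) (i : Fin n) : ℝ := if (i : ℕ) + 1 ≤ t then 1 else 0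

/-- The indicator that a permuted label (in `{1, …, n}`) is `> t`. -/
def highInd {n : ℕ} (t : ℕ) (i : Fin n) : ℝ := if t ≤ (i : ℕ) then 1 else 0

theorem lowInd_mul_highInd {n : ℕ} (t : ℕ) (i : Fin n) : lowInd t i * highInd t i = 0 := by
  unfold lowInd highInd
  split_ifs <;> first | omega | simp

theorem highInd_mul_self {n : ℕ} (t : ℕ) (i : Fin n) :
    highInd t i * highInd t i = highInd t i := by
  unfold highInd
  split_ifs <;> simp

theorem sum_lowInd {n t : ℕ} (ht : t ≤ n) : ∑ i : Fin n, lowInd t i = t := by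
  unfold lowInd
  rw [Fin.sum_univ_eq_sum_range (fun i => if i + 1 ≤ t then (1 : ℝ) else 0) n,
    ← Finset.sum_filter]
  have : (Finset.range n).filter (fun i => i + 1 ≤ t) = Finset.range t := by
    ext i; simp; omega
  rw [this, Finset.sum_const, Finset.card_range, nsmul_one]

theorem sum_highInd {n t : ℕ} (ht : t ≤ n) : ∑ i : Fin n, highInd t i = (n : ℝ) - t := by
  have h : ∀ i : Fin n, highInd t i = 1 - lowInd t i := by
    intro i
    unfold lowInd highInd
    split_ifs <;> first | omega | simp
  simp [h, sum_lowInd ht]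

theorem pexp_sum {n : ℕ} {ι : Type*} (s : Finset ι) (f : ι → Equiv.Perm (Fin n) → ℝ) :
    pexp (fun σ => ∑ i ∈ s, f i σ) = ∑ i ∈ s, pexp (f i) := by
  unfold pexp
  rw [Finset.sum_comm, Finset.sum_div]

theorem pexp_const_mul {n : ℕ} (c : ℝ) (f : Equiv.Perm (Fin n) → ℝ) :
    pexp (fun σ => c * f σ) = c * pexp f := by
  unfold pexp
  rw [← Finset.mul_sum, mul_div_assoc]

theorem pexp_sub {n : ℕ} (f g : Equiv.Perm (Fin n) → ℝ) :
    pexp (fun σ => f σ - g σ) = pexp f - pexp g := by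
  unfold pexp
  rw [Finset.sum_sub_distrib, sub_div]

theorem pexp_const {n : ℕ} (c : ℝ) : pexp (fun _ : Equiv.Perm (Fin n) => c) = c := by
  have : (n.factorial : ℝ) ≠ 0 := by exact_mod_cast n.factorial_ne_zero
  simp [pexp, Fintype.card_perm, this]

theorem pcov_eq {n : ℕ} (f g : Equiv.Perm (Fin n) → ℝ) :
    pcov f g = pexp (fun σ => f σ * g σ) - pexp f * pexp g := by
  have h : (fun σ => (f σ - pexp f) * (g σ - pexp g)) =
      fun σ => (f σ * g σ - pexp g * f σ) - (pexp f * g σ - pexp f * pexp g) := by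
    funext σ; ring
  unfold pcov
  rw [h, pexp_sub, pexp_sub, pexp_sub, pexp_const_mul, pexp_const_mul, pexp_const]
  ring

theorem pexp_comp_mul_right {n : ℕ} (τ : Equiv.Perm (Fin n)) (f : Equiv.Perm (Fin n) → ℝ) :
    pexp (fun σ => f (σ * τ)) = pexp f := by
  unfold pexp
  rw [Equiv.sum_comp (Equiv.mulRight τ) f |>.symm]
  rfl

/-- Averaging over the individuals outside `S`: if `F` is unaffected by exchanging individuals
outside `S`, then they all have the same expectation of `F σ * h (σ a)`. -/
theorem card_mul_pexp_mul {n : ℕ} (S : Finset (Fin n)) (F : Equiv.Perm (Fin n) → ℝ)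
    (hF : ∀ a ∉ S, ∀ b ∉ S, ∀ σ, F (σ * Equiv.swap a b) = F σ) (h : Fin n → ℝ)
    {a : Fin n} (ha : a ∉ S) :
    ((n : ℝ) - S.card) * pexp (fun σ => F σ * h (σ a)) =
      pexp (fun σ => F σ * (∑ i, h i - ∑ s ∈ S, h (σ s))) := by
  have key : ∀ b ∈ Sᶜ, pexp (fun σ => F σ * h (σ b)) = pexp (fun σ => F σ * h (σ a)) := by
    intro b hb
    rw [← pexp_comp_mul_right (Equiv.swap a b) (fun σ => F σ * h (σ a))]
    simp [hF a ha b (by simpa using hb)]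
  have hsum : ∀ σ : Equiv.Perm (Fin n),
      ∑ i, h i - ∑ s ∈ S, h (σ s) = ∑ b ∈ Sᶜ, h (σ b) := by
    intro σ
    rw [← Equiv.sum_comp σ h, ← Finset.sum_add_sum_compl S]
    ring
  simp_rw [hsum, Finset.mul_sum]
  rw [pexp_sum, Finset.sum_congr rfl key, Finset.sum_const, Finset.card_compl, nsmul_eq_mul,
    Nat.cast_sub (Finset.card_le_univ S), Fintype.card_fin]

theorem pexp_apply {n : ℕ} (hn : n ≠ 0) (h : Fin n → ℝ) (a : Fin n) :
    pexp (fun σ => h (σ a)) = (∑ i, h i) / n := by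
  have := card_mul_pexp_mul ∅ (fun _ => 1) (by simp) h (Finset.notMem_empty a)
  simp only [Finset.card_empty, Finset.sum_empty, one_mul, pexp_const, Nat.cast_zero,
    sub_zero] at this
  rw [← this]
  field_simp

theorem pexp_mul_apply {n : ℕ} (hn : 2 ≤ n) (g h : Fin n → ℝ) (c : ℝ)
    (hc : ∀ i, g i * h i = c * g i) {a b : Fin n} (hab : a ≠ b) :
    pexp (fun σ => g (σ a) * h (σ b)) =
      (∑ i, g i) * (∑ i, h i - c) / (n * ((n : ℝ) - 1)) := by
  have hn' : (2 : ℝ) ≤ n := by exact_mod_cast hn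
  have h1 : (n : ℝ) - 1 ≠ 0 := by linarith
  have := card_mul_pexp_mul {a} (fun σ => g (σ a))
    (by
      intro x hx y hy σ
      simp only [Finset.mem_singleton] at hx hy
      simp [Equiv.swap_apply_of_ne_of_ne (Ne.symm hx) (Ne.symm hy)]) h
    (a := b) (by simpa using hab.symm)
  have e : ∀ i, g i * (∑ j, h j - h i) = (∑ j, h j - c) * g i := by
    intro i
    linear_combination -hc i
  simp only [Finset.card_singleton, Finset.sum_singleton, Nat.cast_one, e, pexp_const_mul,
    pexp_apply (by omega : n ≠ 0) g a] at this
  rw [← mul_right_inj' h1, this]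
  field_simp

theorem pexp_high_high {n t : ℕ} (hn : 2 ≤ n) (ht : t ≤ n) {a b : Fin n} (hab : a ≠ b) :
    pexp (fun σ => highInd t (σ a) * highInd t (σ b)) =
      ((n : ℝ) - t) * ((n : ℝ) - t - 1) / (n * ((n : ℝ) - 1)) := by
  rw [pexp_mul_apply hn _ _ 1 (by simp [highInd_mul_self]) hab, sum_highInd ht]

theorem pexp_low_high_high {n t : ℕ} (hn : 3 ≤ n) (ht : t ≤ n) {u a b : Fin n}
    (hua : u ≠ a) (hub : u ≠ b) (hab : a ≠ b) :
    pexp (fun σ => lowInd t (σ u) * highInd t (σ a) * highInd t (σ b)) =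
      (t : ℝ) * ((n : ℝ) - t) * ((n : ℝ) - t - 1) /
        ((n : ℝ) * ((n : ℝ) - 1) * ((n : ℝ) - 2)) := by
  have hn' : (3 : ℝ) ≤ n := by exact_mod_cast hn
  have h1 : (n : ℝ) - 1 ≠ 0 := by linarith
  have h2 : (n : ℝ) - 2 ≠ 0 := by linarith
  have := card_mul_pexp_mul {u, a} (fun σ => lowInd t (σ u) * highInd t (σ a))
    (by
      intro x hx y hy σ
      simp only [Finset.mem_insert, Finset.mem_singleton, not_or] at hx hy
      simp [Equiv.swap_apply_of_ne_of_ne (Ne.symm hx.1) (Ne.symm hy.1),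
        Equiv.swap_apply_of_ne_of_ne (Ne.symm hx.2) (Ne.symm hy.2)]) (highInd t)
    (a := b) (by simp [hub.symm, hab.symm])
  have e : ∀ i j : Fin n, lowInd t i * highInd t j *
      ((n : ℝ) - t - (highInd t i + highInd t j)) =
      ((n : ℝ) - t - 1) * (lowInd t i * highInd t j) := by
    intro i j
    linear_combination (-highInd t j) * lowInd_mul_highInd t i -
      lowInd t i * highInd_mul_self t j
  simp only [Finset.card_pair hua, Finset.sum_pair hua, Nat.cast_ofNat, sum_highInd ht, e,
    pexp_const_mul] at this
  rw [pexp_mul_apply (by omega) _ _ 0 (by simp [lowInd_mul_highInd]) hua, sum_highInd ht,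
    sum_lowInd ht] at this
  rw [← mul_right_inj' h2, this]
  field_simp
  ring

/-- The indicator that both endpoints of `e` belong to individuals with permuted label `> t`. -/
def edgeHigh {n ℓ : ℕ} (t : ℕ) (e : Sym2 (Node n ℓ)) (σ : Equiv.Perm (Fin n)) : ℝ :=
  if ∀ x ∈ e, t ≤ (σ x.1 : ℕ) then 1 else 0

theorem edgeHigh_mk {n ℓ : ℕ} (t : ℕ) (x y : Node n ℓ) (σ : Equiv.Perm (Fin n)) :
    edgeHigh t s(x, y) σ = highInd t (σ x.1) * highInd t (σ y.1) := by
  simp only [edgeHigh, highInd, Sym2.ball, ite_and, mul_ite, mul_one, mul_zero]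
  split_ifs <;> rfl

theorem Rout2_eq_sum {n ℓ : ℕ} (Gr : Finset (Sym2 (Node n ℓ))) (t : ℕ)
    (σ : Equiv.Perm (Fin n)) : (Rout2 Gr t σ : ℝ) = ∑ e ∈ Gout Gr, edgeHigh t e σ := by
  simp [Rout2, edgeHigh]

theorem card_Gin_filter {n ℓ : ℕ} (Gr : Finset (Sym2 (Node n ℓ))) (P : Fin n → Prop) :
    ((Gin Gr).filter fun e => ∀ x ∈ e, P x.1).card =
      ∑ u : Fin n, if P u then D Gr u u else 0 := by
  have hD : ∀ u : Fin n, (if P u then D Gr u u else 0) =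
      ∑ e ∈ Gr, if indPair e = s(u, u) ∧ P u then 1 else 0 := by
    intro u
    by_cases hu : P u <;> simp [hu, D]
  simp_rw [hD]
  rw [Finset.sum_comm, Gin, Finset.filter_filter, Finset.card_filter]
  refine Finset.sum_congr rfl fun e _ => ?_
  induction e using Sym2.ind with
  | _ x y =>
    simp only [indPair, Sym2.map_mk, Sym2.mk_isDiag_iff, Sym2.ball, Sym2.eq_iff, or_self]
    by_cases hxy : x.1 = y.1
    · simp [hxy, ite_and]
    · rw [if_neg (by tauto), eq_comm]
      refine Finset.sum_eq_zero fun u _ => if_neg ?_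
      rintro ⟨⟨h1, h2⟩, -⟩
      exact hxy (h1.trans h2.symm)

theorem Rin1_eq_sum {n ℓ : ℕ} (Gr : Finset (Sym2 (Node n ℓ))) (t : ℕ)
    (σ : Equiv.Perm (Fin n)) :
    (Rin1 Gr t σ : ℝ) = ∑ u : Fin n, (D Gr u u : ℝ) * lowInd t (σ u) := by
  have h : Rin1 Gr t σ = ∑ u : Fin n, if (σ u : ℕ) + 1 ≤ t then D Gr u u else 0 := by
    unfold Rin1
    convert card_Gin_filter Gr fun u => (σ u : ℕ) + 1 ≤ t
  simp [h, lowInd]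

theorem card_Gin {n ℓ : ℕ} (Gr : Finset (Sym2 (Node n ℓ))) :
    (Gin Gr).card = ∑ u : Fin n, D Gr u u := by
  simpa using card_Gin_filter Gr fun _ => True

theorem Ddeg_eq_card {n ℓ : ℕ} (Gr : Finset (Sym2 (Node n ℓ))) (u : Fin n) :
    Ddeg Gr u = ((Gout Gr).filter fun e => u ∈ indPair e).card := by
  simp only [Ddeg, D, Gout, Finset.filter_filter, Finset.card_filter]
  rw [Finset.sum_comm]
  refine Finset.sum_congr rfl fun e _ => ?_
  generalize indPair e = p
  induction p using Sym2.ind with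
  | _ a b =>
    rw [← Finset.card_filter, Finset.filter_filter]
    simp only [Sym2.mk_isDiag_iff, Sym2.mem_iff, Sym2.eq_iff]
    split_ifs with h
    · obtain ⟨hab, rfl | rfl⟩ := h
      · rw [Finset.card_eq_one]
        refine ⟨b, ?_⟩
        ext v; simp; grind
      · rw [Finset.card_eq_one]
        refine ⟨a, ?_⟩
        ext v; simp; grind
    · rw [Finset.card_eq_zero]
      ext v; simp; grind

theorem pexp_edgeHigh {n ℓ t : ℕ} (hn : 2 ≤ n) (ht : t ≤ n) {e : Sym2 (Node n ℓ)}
    (he : ¬ (indPair e).IsDiag) :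
    pexp (edgeHigh t e) = ((n : ℝ) - t) * ((n : ℝ) - t - 1) / (n * ((n : ℝ) - 1)) := by
  induction e using Sym2.ind with
  | _ x y =>
    rw [← pexp_high_high hn ht (a := x.1) (b := y.1) (by simpa [indPair] using he)]
    simp_rw [← edgeHigh_mk]

theorem pexp_low_edgeHigh {n ℓ t : ℕ} (hn : 3 ≤ n) (ht : t ≤ n) {e : Sym2 (Node n ℓ)}
    (he : ¬ (indPair e).IsDiag) (u : Fin n) :
    pexp (fun σ => lowInd t (σ u) * edgeHigh t e σ) =
      (t : ℝ) * ((n : ℝ) - t) * ((n : ℝ) - t - 1) /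
        ((n : ℝ) * ((n : ℝ) - 1) * ((n : ℝ) - 2)) * (1 - if u ∈ indPair e then 1 else 0) := by
  induction e using Sym2.ind with
  | _ x y =>
    simp only [indPair, Sym2.map_mk, Sym2.mk_isDiag_iff, Sym2.mem_iff] at he ⊢
    simp_rw [edgeHigh_mk, ← mul_assoc]
    split_ifs with h
    · have hz : ∀ σ : Equiv.Perm (Fin n),
          lowInd t (σ u) * highInd t (σ x.1) * highInd t (σ y.1) = 0 := by
        intro σ
        rcases h with rfl | rfl
        · rw [lowInd_mul_highInd, zero_mul]
        · rw [mul_right_comm, lowInd_mul_highInd, zero_mul]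
      simp [hz, pexp_const]
    · rw [not_or] at h
      rw [pexp_low_high_high hn ht h.1 h.2 he, sub_zero, mul_one]

/-- Covariance of `R_out,2(t)` and `R_in,1(t)` under the permutation null
distribution. -/
theorem cov_Rout2_Rin1 (n ℓ : ℕ) (Gr : Finset (Sym2 (Node n ℓ)))
    (hG : ∀ e ∈ Gr, ¬ e.IsDiag) (hn : 3 ≤ n) (t : ℕ) (ht1 : 1 ≤ t) (ht2 : t ≤ n - 1) :
    pcov (fun σ => (Rout2 Gr t σ : ℝ)) (fun σ => (Rin1 Gr t σ : ℝ)) =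
      -((t : ℝ) * ((n : ℝ) - t) * ((n : ℝ) - t - 1) /
          ((n : ℝ) * ((n : ℝ) - 1) * ((n : ℝ) - 2)) *
        ((∑ u : Fin n, (D Gr u u : ℝ) * (Ddeg Gr u : ℝ)) -
          2 / (n : ℝ) * ((Gin Gr).card : ℝ) * ((Gout Gr).card : ℝ))) := by
  have ht : t ≤ n := by omega
  have hn' : (3 : ℝ) ≤ n := by exact_mod_cast hn
  have h0 : (n : ℝ) ≠ 0 := by linarith
  have h1 : (n : ℝ) - 1 ≠ 0 := by linarith
  have h2 : (n : ℝ) - 2 ≠ 0 := by linarith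
  have hout : ∀ e ∈ Gout Gr, ¬ (indPair e).IsDiag := fun e he => (Finset.mem_filter.mp he).2
  have hR2 : pexp (fun σ => (Rout2 Gr t σ : ℝ)) =
      (Gout Gr).card * (((n : ℝ) - t) * ((n : ℝ) - t - 1) / (n * ((n : ℝ) - 1))) := by
    simp_rw [Rout2_eq_sum]
    rw [pexp_sum, Finset.sum_congr rfl fun e he => pexp_edgeHigh (by omega) ht (hout e he),
      Finset.sum_const, nsmul_eq_mul]
  have hR1 : pexp (fun σ => (Rin1 Gr t σ : ℝ)) = (Gin Gr).card * (t / n) := by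
    simp_rw [Rin1_eq_sum]
    rw [pexp_sum, card_Gin, Nat.cast_sum, Finset.sum_mul]
    refine Finset.sum_congr rfl fun u _ => ?_
    rw [pexp_const_mul, pexp_apply (by omega) (lowInd t) u, sum_lowInd ht]
  have hR : pexp (fun σ => (Rout2 Gr t σ : ℝ) * (Rin1 Gr t σ : ℝ)) =
      ∑ u : Fin n, (D Gr u u : ℝ) * ((t : ℝ) * ((n : ℝ) - t) * ((n : ℝ) - t - 1) /
        ((n : ℝ) * ((n : ℝ) - 1) * ((n : ℝ) - 2)) * ((Gout Gr).card - Ddeg Gr u)) := by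
    have hprod : ∀ σ, (Rout2 Gr t σ : ℝ) * (Rin1 Gr t σ : ℝ) =
        ∑ u : Fin n, (D Gr u u : ℝ) * ∑ e ∈ Gout Gr, lowInd t (σ u) * edgeHigh t e σ := by
      intro σ
      rw [Rout2_eq_sum, Rin1_eq_sum, Finset.mul_sum]
      refine Finset.sum_congr rfl fun u _ => ?_
      rw [← Finset.mul_sum]
      ring
    simp_rw [hprod]
    rw [pexp_sum]
    refine Finset.sum_congr rfl fun u _ => ?_
    rw [pexp_const_mul, pexp_sum,
      Finset.sum_congr rfl fun e he => pexp_low_edgeHigh hn ht (hout e he) u,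
      ← Finset.mul_sum, Ddeg_eq_card]
    simp
  have hsum : ∀ K : ℝ, ∑ u : Fin n, (D Gr u u : ℝ) * (K * ((Gout Gr).card - Ddeg Gr u)) =
      K * ((Gin Gr).card * (Gout Gr).card - ∑ u : Fin n, (D Gr u u : ℝ) * Ddeg Gr u) := by
    intro K
    rw [card_Gin, Nat.cast_sum, Finset.sum_mul, ← Finset.sum_sub_distrib, Finset.mul_sum]
    exact Finset.sum_congr rfl fun u _ => by ring
  rw [pcov_eq, hR, hsum, hR1, hR2]
  field_simp
  ring

end CPD
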